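/- arXiv:1808.03050 — 4 statements merged into one kernel-verified Lean document; each statement's English description precedes it below -/
import Mathlib

section
/- Let α > 2 and a > 0 be real numbers. Then the expectation, when g is drawn from the exponential distribution with rate 1 on (0,∞), of the quantity ∫₀^∞ (1 − e^{−a g u^{−α}}) u du equals (a^{2/α}/2) · Γ(1 + 2/α) · Γ(1 − 2/α). Equivalently, ∫₀^∞ e^{−g} · (∫₀^∞ (1 − e^{−a g u^{−α}}) u du) dg = (a^{2/α}/2) · Γ(1 + 2/α) · Γ(1 − 2/α). -/
open MeasureTheory Real Set
open Filter Topology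

theorem one_sub_exp_neg_mul_nonneg {c t : ℝ} (hc : 0 ≤ c) (ht : 0 ≤ t) :
    0 ≤ 1 - exp (-(c * t)) :=
  sub_nonneg.2 (exp_le_one_iff.2 (neg_nonpos.2 (by positivity)))

theorem integrableOn_one_sub_exp_mul_rpow {c δ : ℝ} (hc : 0 < c) (h₀ : 0 < δ) (h₁ : δ < 1) :
    IntegrableOn (fun t : ℝ ↦ (1 - exp (-(c * t))) * t ^ (-δ - 1)) (Ioi 0) := by
  have hcont : ContinuousOn (fun t : ℝ ↦ (1 - exp (-(c * t))) * t ^ (-δ - 1)) (Ioi 0) :=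
    ContinuousOn.mul (by fun_prop) fun t ht ↦
      (continuousAt_rpow_const t _ (Or.inl (ne_of_gt ht))).continuousWithinAt
  rw [← Ioc_union_Ioi_eq_Ioi zero_le_one]
  refine IntegrableOn.union ?_ ?_
  · have hint : IntegrableOn (fun t : ℝ ↦ c * t ^ (-δ)) (Ioc 0 1) := by
      rw [← intervalIntegrable_iff_integrableOn_Ioc_of_le zero_le_one]
      exact (intervalIntegral.intervalIntegrable_rpow' (by linarith)).const_mul c
    refine hint.mono' ((hcont.mono Ioc_subset_Ioi_self).aestronglyMeasurable measurableSet_Ioc) ?_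
    filter_upwards [ae_restrict_mem measurableSet_Ioc] with t ht
    have ht₀ : 0 < t := ht.1
    rw [norm_of_nonneg (mul_nonneg (one_sub_exp_neg_mul_nonneg hc.le ht₀.le) (by positivity))]
    calc (1 - exp (-(c * t))) * t ^ (-δ - 1) ≤ c * t * t ^ (-δ - 1) := by
          gcongr
          linarith [add_one_le_exp (-(c * t))]
      _ = c * t ^ (-δ) := by
          rw [rpow_sub_one ht₀.ne']
          field_simp
  · have hint : IntegrableOn (fun t : ℝ ↦ t ^ (-δ - 1)) (Ioi 1) :=
      integrableOn_Ioi_rpow_of_lt (by linarith) one_pos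
    refine hint.mono' ((hcont.mono (Ioi_subset_Ioi zero_le_one)).aestronglyMeasurable
      measurableSet_Ioi) ?_
    filter_upwards [ae_restrict_mem measurableSet_Ioi] with t ht
    have ht₀ : 0 < t := zero_lt_one.trans ht
    rw [norm_of_nonneg (mul_nonneg (one_sub_exp_neg_mul_nonneg hc.le ht₀.le) (by positivity))]
    exact mul_le_of_le_one_left (by positivity) (by linarith [exp_pos (-(c * t))])

theorem integral_one_sub_exp_mul_rpow {c δ : ℝ} (hc : 0 < c) (h₀ : 0 < δ) (h₁ : δ < 1) :
    ∫ t in Ioi (0 : ℝ), (1 - exp (-(c * t))) * t ^ (-δ - 1) = c ^ δ * Gamma (1 - δ) / δ := by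
  have hparts := integral_Ioi_mul_deriv_eq_deriv_mul (a := (0 : ℝ)) (a' := 0) (b' := 0)
    (u := fun t ↦ 1 - exp (-(c * t))) (u' := fun t ↦ c * exp (-(c * t)))
    (v := fun t ↦ t ^ (-δ)) (v' := fun t ↦ -δ * t ^ (-δ - 1))
    (fun t _ ↦ by
      have hexp : HasDerivAt (fun t ↦ exp (-(c * t))) (exp (-(c * t)) * -(c * 1)) t :=
        ((hasDerivAt_id t).const_mul c).neg.exp
      exact (hexp.const_sub 1).congr_deriv (by ring))
    (fun t ht ↦ hasDerivAt_rpow_const (Or.inl (ne_of_gt ht)))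
    (((integrableOn_one_sub_exp_mul_rpow hc h₀ h₁).const_mul (-δ)).congr
      (.of_forall fun t ↦ by simp; ring))
    (((integrableOn_rpow_mul_exp_neg_mul_rpow (s := -δ) (p := 1) (b := c)
      (by linarith) one_pos hc).const_mul c).congr
      (.of_forall fun t ↦ by simp; ring))
    (by
      have hlim : Tendsto (fun t : ℝ ↦ c * t ^ (1 - δ)) (𝓝[>] 0) (𝓝 0) := by
        have := ((continuousAt_rpow_const (0 : ℝ) (1 - δ) (Or.inr (by linarith))).const_mul c).tendsto
        rw [zero_rpow (by linarith), mul_zero] at this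
        exact this.mono_left nhdsWithin_le_nhds
      refine squeeze_zero' ?_ ?_ hlim
      · filter_upwards [self_mem_nhdsWithin] with t (ht : 0 < t)
        exact mul_nonneg (one_sub_exp_neg_mul_nonneg hc.le ht.le) (by positivity)
      · filter_upwards [self_mem_nhdsWithin] with t (ht : 0 < t)
        rw [sub_eq_add_neg 1 δ, rpow_add ht, rpow_one, ← mul_assoc]
        simp only [Pi.mul_apply]
        gcongr
        linarith [add_one_le_exp (-(c * t))])
    (by
      refine squeeze_zero' ?_ ?_ (tendsto_rpow_neg_atTop h₀)
      · filter_upwards [eventually_gt_atTop 0] with t ht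
        exact mul_nonneg (one_sub_exp_neg_mul_nonneg hc.le ht.le) (by positivity)
      · filter_upwards [eventually_gt_atTop 0] with t ht
        exact mul_le_of_le_one_left (by positivity) (by linarith [exp_pos (-(c * t))]))
  have hgamma := integral_rpow_mul_exp_neg_mul_Ioi (a := 1 - δ) (r := c) (by linarith) hc
  have hleft : ∫ t in Ioi (0 : ℝ), (1 - exp (-(c * t))) * (-δ * t ^ (-δ - 1)) =
      -δ * ∫ t in Ioi (0 : ℝ), (1 - exp (-(c * t))) * t ^ (-δ - 1) := by
    rw [← integral_const_mul]
    exact integral_congr_ae (.of_forall fun t ↦ by simp only; ring)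
  have hright : ∫ t in Ioi (0 : ℝ), c * exp (-(c * t)) * t ^ (-δ) = c ^ δ * Gamma (1 - δ) := by
    have hpow : c * (1 / c) ^ (1 - δ) = c ^ δ := by
      rw [one_div, inv_rpow hc.le, ← rpow_neg hc.le, neg_sub, rpow_sub_one hc.ne']
      field_simp
    rw [← hpow, mul_assoc, ← hgamma, ← integral_const_mul]
    refine integral_congr_ae (.of_forall fun t ↦ ?_)
    simp only [show 1 - δ - 1 = -δ by ring]
    ring
  rw [hleft, hright] at hparts
  rw [eq_div_iff h₀.ne']
  linarith

theorem integral_one_sub_exp_rpow_neg_mul {c α : ℝ} (hc : 0 < c) (hα : 2 < α) :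
    ∫ u in Ioi (0 : ℝ), (1 - exp (-(c * u ^ (-α)))) * u =
      c ^ (2 / α) / 2 * Gamma (1 - 2 / α) := by
  have hα₀ : 0 < α := by linarith
  have hsubst := integral_comp_rpow_Ioi
    (fun t : ℝ ↦ (1 - exp (-(c * t))) * t ^ (-(2 / α) - 1)) (neg_ne_zero.2 hα₀.ne')
  rw [integral_one_sub_exp_mul_rpow hc (by positivity) ((div_lt_one hα₀).2 hα)] at hsubst
  have hleft : ∫ u in Ioi (0 : ℝ), (|-α| * u ^ (-α - 1)) •
      ((1 - exp (-(c * u ^ (-α)))) * (u ^ (-α)) ^ (-(2 / α) - 1)) =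
      α * ∫ u in Ioi (0 : ℝ), (1 - exp (-(c * u ^ (-α)))) * u := by
    rw [← integral_const_mul]
    refine setIntegral_congr_fun measurableSet_Ioi fun u (hu : 0 < u) ↦ ?_
    have hpow : u ^ (-α - 1) * (u ^ (-α)) ^ (-(2 / α) - 1) = u := by
      rw [← rpow_mul hu.le, ← rpow_add hu,
        show -α - 1 + -α * (-(2 / α) - 1) = 1 by field_simp; ring, rpow_one]
    simp only [abs_neg, abs_of_pos hα₀, smul_eq_mul]
    linear_combination α * (1 - exp (-(c * u ^ (-α)))) * hpow
  rw [hleft] at hsubst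
  field_simp at hsubst ⊢
  linarith

/-- For `α > 2` and `a > 0`, the expectation over `g ~ Exp(1)` of
`∫₀^∞ (1 − e^{−a g u^{−α}}) u du` equals `(a^{2/α}/2) Γ(1 + 2/α) Γ(1 − 2/α)`. -/
theorem stmt_2 (α a : ℝ) (hα : 2 < α) (ha : 0 < a) :
    ∫ g in Set.Ioi (0 : ℝ), Real.exp (-g) *
        (∫ u in Set.Ioi (0 : ℝ), (1 - Real.exp (-(a * g * u ^ (-α)))) * u)
      = a ^ (2 / α) / 2 * Real.Gamma (1 + 2 / α) * Real.Gamma (1 - 2 / α) := by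
  have hα₀ : 0 < α := by linarith
  rw [Gamma_eq_integral (s := 1 + 2 / α) (by positivity), mul_right_comm, ← integral_const_mul]
  refine setIntegral_congr_fun measurableSet_Ioi fun g (hg : 0 < g) ↦ ?_
  simp only [integral_one_sub_exp_rpow_neg_mul (mul_pos ha hg) hα, mul_rpow ha.le hg.le,
    add_sub_cancel_left]
  ring
end

section
/- Let n ≥ 1 be a natural number and let c_d, c_b be real numbers with 0 ≤ c_d ≤ c_b. Then the function f : ℝ → ℝ defined by f(b) = c_d · ((1 − b) − (1 − b)ⁿ) + c_b · (1 − b)ⁿ is convex on the interval [0, 1]. -/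
/-- The per-file expected energy
`f(b) = c_d ((1 − b) − (1 − b)ⁿ) + c_b (1 − b)ⁿ` is convex on `[0, 1]`
when `n ≥ 1` and `0 ≤ c_d ≤ c_b`. -/
theorem stmt_7 (n : ℕ) (hn : 1 ≤ n) (cd cb : ℝ) (hcd : 0 ≤ cd) (hcb : cd ≤ cb) :
    ConvexOn ℝ (Set.Icc (0 : ℝ) 1)
      (fun b : ℝ => cd * ((1 - b) - (1 - b) ^ n) + cb * (1 - b) ^ n) := by
  refine ⟨convex_Icc 0 1, fun x hx y hy s t hs ht hst => ?_⟩
  have hpow := (convexOn_pow n).2 (Set.mem_Ici.2 (sub_nonneg.2 hx.2))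
    (Set.mem_Ici.2 (sub_nonneg.2 hy.2)) hs ht hst
  simp only [smul_eq_mul] at hpow ⊢
  have haff : 1 - (s * x + t * y) = s * (1 - x) + t * (1 - y) := by
    linear_combination -hst
  rw [haff]
  linear_combination (cb - cd) * hpow
end

section
/- Let N ≥ 1 and n ≥ 1 be natural numbers, let c_d, c_b be reals with 0 ≤ c_d ≤ c_b, and let w₁, …, w_N be nonnegative reals. Then the function F : ℝᴺ → ℝ defined by F(b) = Σ_{i=1}^{N} wᵢ · ( c_d · ((1 − bᵢ) − (1 − bᵢ)ⁿ) + c_b · (1 − bᵢ)ⁿ ) is convex on the box [0,1]ᴺ. -/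
open Finset

/-- The total energy
`F(b) = Σᵢ wᵢ (c_d ((1 − bᵢ) − (1 − bᵢ)ⁿ) + c_b (1 − bᵢ)ⁿ)` is convex on the
box `[0,1]ᴺ` when `n ≥ 1`, `0 ≤ c_d ≤ c_b` and the weights `wᵢ` are
nonnegative. -/
theorem stmt_9 (N n : ℕ) (hN : 1 ≤ N) (hn : 1 ≤ n) (cd cb : ℝ)
    (hcd : 0 ≤ cd) (hcb : cd ≤ cb) (w : Fin N → ℝ) (hw : ∀ i, 0 ≤ w i) :
    ConvexOn ℝ (Set.Icc (0 : Fin N → ℝ) 1)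
      (fun b : Fin N → ℝ => ∑ i : Fin N,
        w i * (cd * ((1 - b i) - (1 - b i) ^ n) + cb * (1 - b i) ^ n)) := by
  refine ⟨convex_Icc 0 1, ?_⟩
  intro x hx y hy s t hs ht hst
  simp only [smul_eq_mul, Pi.add_apply, Pi.smul_apply, Finset.mul_sum]
  rw [← Finset.sum_add_distrib]
  refine Finset.sum_le_sum fun i _ => ?_
  have hxi : (0 : ℝ) ≤ 1 - x i := sub_nonneg.mpr (hx.2 i)
  have hyi : (0 : ℝ) ≤ 1 - y i := sub_nonneg.mpr (hy.2 i)
  have hcombo : 1 - (s * x i + t * y i) = s * (1 - x i) + t * (1 - y i) := by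
    linear_combination -hst
  have hpow : (s * (1 - x i) + t * (1 - y i)) ^ n
      ≤ s * (1 - x i) ^ n + t * (1 - y i) ^ n := by
    simpa only [smul_eq_mul] using (convexOn_pow n).2 hxi hyi hs ht hst
  rw [hcombo]
  calc
    _ = w i * (cd * (s * (1 - x i) + t * (1 - y i))
          + (cb - cd) * (s * (1 - x i) + t * (1 - y i)) ^ n) := by ring
    _ ≤ w i * (cd * (s * (1 - x i) + t * (1 - y i))
          + (cb - cd) * (s * (1 - x i) ^ n + t * (1 - y i) ^ n)) := by
      have := mul_le_mul_of_nonneg_left hpow (sub_nonneg.mpr hcb)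
      exact mul_le_mul_of_nonneg_left (by linarith) (hw i)
    _ = _ := by ring
end

section
/- Let N ≥ 1 be a natural number, n ≥ 2 a natural number, c_d, c_b reals with 0 < c_d < c_b, w₁, …, w_N positive reals, and M a real number. Suppose v is a real number with v ≥ wᵢ · c_d for every i, define for each i the value bᵢ* = max(0, 1 − ((v − wᵢ c_d)/(wᵢ n (c_b − c_d)))^{1/(n−1)}), and assume Σ_{i=1}^{N} bᵢ* = M. Then b* = (b₁*, …, b_N*) minimizes F(b) = Σ_{i=1}^{N} wᵢ ( c_d ((1 − bᵢ) − (1 − bᵢ)ⁿ) + c_b (1 − bᵢ)ⁿ ) over the feasible set { b ∈ ℝᴺ : 0 ≤ bᵢ ≤ 1 for all i and Σ_{i=1}^{N} bᵢ = M }; i.e., F(b*) ≤ F(b) for every feasible b. -/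
open Finset

/-- The tangent-line inequality for `x ↦ x ^ (m + 1)` on the nonnegative reals. -/
theorem pow_succ_add_tangent_le {x t : ℝ} (hx : 0 ≤ x) (ht : 0 ≤ t) (m : ℕ) :
    t ^ (m + 1) + (m + 1) * t ^ m * (x - t) ≤ x ^ (m + 1) := by
  induction m with
  | zero => simp
  | succ k ih =>
    have h₁ := mul_le_mul_of_nonneg_right ih hx
    have h₂ : 0 ≤ ((k : ℝ) + 1) * t ^ k * (x - t) ^ 2 := by positivity
    push_cast
    linear_combination h₁ + h₂

/-- If `x ≤ 1` and `t = min 1 y`, where the slope of `c * x + d * x ^ (m + 1)` at `y` is `v`,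
then the line of slope `v` through the graph at `t` lies below the graph at `x`. -/
theorem add_mul_pow_supporting_line {c d v x y : ℝ} {m : ℕ} (hd : 0 ≤ d) (hx₀ : 0 ≤ x)
    (hx₁ : x ≤ 1) (hy : 0 ≤ y) (hv : c + d * ((m + 1) * y ^ m) = v) :
    c * min 1 y + d * min 1 y ^ (m + 1) + v * (x - min 1 y) ≤ c * x + d * x ^ (m + 1) := by
  have ht : 0 ≤ min 1 y := le_min zero_le_one hy
  have htan := mul_le_mul_of_nonneg_left (pow_succ_add_tangent_le hx₀ ht m) hd
  suffices h : v * (x - min 1 y) ≤ (c + d * ((m + 1) * min 1 y ^ m)) * (x - min 1 y) by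
    linear_combination htan + h
  rcases le_total y 1 with hy₁ | hy₁
  · rw [min_eq_right hy₁, hv]
  · rw [min_eq_left hy₁, ← hv]
    refine mul_le_mul_of_nonpos_right ?_ (sub_nonpos.2 hx₁)
    gcongr

/-- Lemma 3 of the paper: the water-filling caching distribution
`bᵢ* = [1 − ((v − wᵢ c_d)/(wᵢ n (c_b − c_d)))^{1/(n−1)}]⁺` (with Lagrange
multiplier `v` chosen so that `Σᵢ bᵢ* = M`) minimizes the energy
`F(b) = Σᵢ wᵢ (c_d ((1 − bᵢ) − (1 − bᵢ)ⁿ) + c_b (1 − bᵢ)ⁿ)` over all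
`b ∈ [0,1]ᴺ` with `Σᵢ bᵢ = M`. -/
theorem stmt_10 (N n : ℕ) (hN : 1 ≤ N) (hn : 2 ≤ n) (cd cb : ℝ)
    (hcd : 0 < cd) (hcb : cd < cb) (w : Fin N → ℝ) (hw : ∀ i, 0 < w i)
    (M v : ℝ) (hv : ∀ i, w i * cd ≤ v) (bstar : Fin N → ℝ)
    (hbstar : ∀ i, bstar i =
      max 0 (1 - ((v - w i * cd) / (w i * n * (cb - cd))) ^ (1 / ((n : ℝ) - 1))))
    (hsum : ∑ i : Fin N, bstar i = M) :
    ∀ b : Fin N → ℝ, (∀ i, 0 ≤ b i ∧ b i ≤ 1) → ∑ i : Fin N, b i = M →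
      ∑ i : Fin N, w i * (cd * ((1 - bstar i) - (1 - bstar i) ^ n)
          + cb * (1 - bstar i) ^ n)
        ≤ ∑ i : Fin N, w i * (cd * ((1 - b i) - (1 - b i) ^ n)
          + cb * (1 - b i) ^ n) := by
  intro b hb hbsum
  obtain ⟨m, rfl⟩ : ∃ m, n = m + 1 := ⟨n - 1, by lia⟩
  have hm : m ≠ 0 := by lia
  have key : ∀ i, w i * (cd * ((1 - bstar i) - (1 - bstar i) ^ (m + 1))
      + cb * (1 - bstar i) ^ (m + 1)) + v * (bstar i - b i)
      ≤ w i * (cd * ((1 - b i) - (1 - b i) ^ (m + 1)) + cb * (1 - b i) ^ (m + 1)) := by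
    intro i
    have hwi := hw i
    have hc : 0 < cb - cd := sub_pos.2 hcb
    have hA : 0 ≤ (v - w i * cd) / (w i * (m + 1 : ℕ) * (cb - cd)) :=
      div_nonneg (sub_nonneg.2 (hv i)) (by positivity)
    have hbi := hbstar i
    have hexp : 1 / (((m + 1 : ℕ) : ℝ) - 1) = (m : ℝ)⁻¹ := by simp
    rw [hexp] at hbi
    set A := (v - w i * cd) / (w i * (m + 1 : ℕ) * (cb - cd)) with hAdef
    have hpow : (A ^ (m : ℝ)⁻¹) ^ m = A := Real.rpow_inv_natCast_pow hA hm
    have ht : 1 - bstar i = min 1 (A ^ (m : ℝ)⁻¹) := by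
      rw [hbi, ← min_sub_sub_left, sub_zero, sub_sub_cancel]
    have hslope : w i * cd + w i * (cb - cd) * ((m + 1) * (A ^ (m : ℝ)⁻¹) ^ m) = v := by
      rw [hpow, hAdef]
      push_cast
      field_simp
      ring
    have h := add_mul_pow_supporting_line (mul_pos hwi hc).le (sub_nonneg.2 (hb i).2)
      (sub_le_self 1 (hb i).1) (Real.rpow_nonneg hA _) hslope
    rw [← ht] at h
    linear_combination h
  have h := sum_le_sum fun i (_ : i ∈ univ) => key i
  rw [sum_add_distrib, ← mul_sum, sum_sub_distrib, hsum, hbsum, sub_self, mul_zero,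
    add_zero] at h
  exact h
end
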